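/- arXiv:1311.7082 — 2 statements merged into one kernel-verified Lean document; each statement's English description precedes it below -/
import Mathlib

section
/- For every integer p ≥ 1 there exists n₀ ≥ p + 1 such that for all n ≥ n₀, every nonconstant function f : [n]^(p) → ℕ^(p) fixes an intersection. -/
/-- The step from `r`-tuples to `(r+1)`-tuples in Ramsey's theorem: a large enough set has a subset
on which the colour of an increasing tuple depends only on its first entry. -/
theorem exists_end_homogeneous {C : Type*} [Nonempty C] (r : ℕ)
    (ih : ∀ m : ℕ, ∃ N : ℕ, ∀ (A : Finset ℕ), N ≤ A.card → ∀ χ : (Fin r → ℕ) → C,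
      ∃ H ⊆ A, H.card = m ∧ ∃ c, ∀ z, StrictMono z → (∀ i, z i ∈ H) → χ z = c) (t : ℕ) :
    ∃ N : ℕ, ∀ (A : Finset ℕ), N ≤ A.card → ∀ χ : (Fin (r + 1) → ℕ) → C,
      ∃ T ⊆ A, T.card = t ∧ ∃ g : ℕ → C,
        ∀ z, StrictMono z → (∀ i, z i ∈ T) → χ z = g (z 0) := by
  induction t with
  | zero =>
    refine ⟨0, fun A _ χ => ⟨∅, by simp, by simp, fun _ => Classical.arbitrary C, ?_⟩⟩
    intro z _ hz
    simpa using hz 0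
  | succ t iht =>
    obtain ⟨N, hN⟩ := iht
    obtain ⟨N', hN'⟩ := ih N
    refine ⟨N' + 1, fun A hA χ => ?_⟩
    have hne : A.Nonempty := Finset.card_pos.mp (by omega)
    set a := A.min' hne with ha
    have haA : a ∈ A := A.min'_mem hne
    obtain ⟨H, hHA, hHc, c, hc⟩ := hN' (A.erase a)
      (by rw [Finset.card_erase_of_mem haA]; omega) (fun z => χ (Fin.cons a z))
    obtain ⟨T, hTH, hTc, g, hg⟩ := hN H hHc.ge χ
    have hTA : T ⊆ A.erase a := hTH.trans hHA
    have haT : a ∉ T := fun h => by simpa using hTA h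
    have hlt : ∀ b ∈ T, a < b := fun b hb =>
      lt_of_le_of_ne (A.min'_le b (Finset.mem_of_mem_erase (hTA hb)))
        (Finset.ne_of_mem_erase (hTA hb)).symm
    refine ⟨insert a T, ?_, by rw [Finset.card_insert_of_notMem haT, hTc],
      Function.update g a c, ?_⟩
    · exact Finset.insert_subset haA (hTA.trans (Finset.erase_subset _ _))
    · intro z hz hzT
      rcases eq_or_ne (z 0) a with h0 | h0
      · rw [h0, Function.update_self, ← hc (Fin.tail z), ← h0, Fin.cons_self_tail]
        · intro i j hij
          exact hz (Fin.succ_lt_succ_iff.mpr hij)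
        · intro i
          refine hTH ((Finset.mem_insert.mp (hzT i.succ)).resolve_left ?_)
          rw [← h0]
          exact (hz i.succ_pos).ne'
      · rw [Function.update_of_ne h0]
        have h0T := (Finset.mem_insert.mp (hzT 0)).resolve_left h0
        refine hg z hz fun i => (Finset.mem_insert.mp (hzT i)).resolve_left ?_
        exact ((hlt _ h0T).trans_le (hz.monotone (Fin.zero_le i))).ne'

/-- Ramsey's theorem for finite colourings of increasing `r`-tuples. -/
theorem exists_homogeneous {C : Type*} [Finite C] [Nonempty C] (r : ℕ) :
    ∀ m : ℕ, ∃ N : ℕ, ∀ (A : Finset ℕ), N ≤ A.card → ∀ χ : (Fin r → ℕ) → C,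
      ∃ H ⊆ A, H.card = m ∧ ∃ c, ∀ z, StrictMono z → (∀ i, z i ∈ H) → χ z = c := by
  classical
  have := Fintype.ofFinite C
  induction r with
  | zero =>
    intro m
    refine ⟨m, fun A hA χ => ?_⟩
    obtain ⟨H, hHA, hH⟩ := Finset.exists_subset_card_eq hA
    exact ⟨H, hHA, hH, χ Fin.elim0, fun z _ _ => congrArg χ (Subsingleton.elim _ _)⟩
  | succ r ih =>
    intro m
    obtain ⟨N, hN⟩ := exists_end_homogeneous r ih (Fintype.card C * m)
    refine ⟨N, fun A hA χ => ?_⟩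
    obtain ⟨T, hTA, hTc, g, hg⟩ := hN A hA χ
    obtain ⟨c, -, hc⟩ := Finset.exists_le_card_fiber_of_mul_le_card_of_maps_to
      (s := T) (t := Finset.univ) (f := g) (n := m) (fun _ _ => Finset.mem_univ _)
      Finset.univ_nonempty (by rw [hTc, Finset.card_univ])
    obtain ⟨H, hH, hHc⟩ := Finset.exists_subset_card_eq hc
    refine ⟨H, (hH.trans (Finset.filter_subset _ _)).trans hTA, hHc, c, fun z hz hzH => ?_⟩
    rw [hg z hz fun i => (Finset.mem_filter.mp (hH (hzH i))).1]
    exact (Finset.mem_filter.mp (hH (hzH 0))).2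

/-- If the size of `φ v ∩ φ w`, for `v ≤ w`, depends only on the set of coordinates where `v` and
`w` agree, then it is monotone in this set. -/
theorem grid_inter_card_le_insert {p : ℕ} (φ : (Fin p → Fin (2 ^ p + 1 + 1)) → Finset ℕ)
    (hφ : ∀ v, (φ v).card = p) (F : Finset (Fin p) → ℕ)
    (hF : ∀ v w, v ≤ w → (φ v ∩ φ w).card = F {i | v i = w i})
    (J : Finset (Fin p)) (k : Fin p) : F J ≤ F (insert k J) := by
  classical
  let y : Fin (2 ^ p + 1) → Fin p → Fin (2 ^ p + 1 + 1) :=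
    fun s i => if i ∈ J then 0 else if i = k then Fin.succ 0 else s.succ
  obtain ⟨s, -, t, -, hst, h⟩ := Finset.exists_ne_map_eq_of_card_lt_of_maps_to
    (s := Finset.univ) (t := (φ 0).powerset) (f := fun s => φ 0 ∩ φ (y s))
    (by simp [hφ]) (by intro s _; simp)
  wlog hlt : s < t generalizing s t
  · exact this t s hst.symm h.symm (lt_of_le_of_ne (not_lt.mp hlt) hst.symm)
  have h0 : (φ 0 ∩ φ (y s)).card = F J := by
    rw [hF 0 (y s) (fun i => Fin.zero_le _)]
    congr 1
    ext i
    simp only [Finset.mem_filter, Finset.mem_univ, true_and, Pi.zero_apply, y]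
    split_ifs with h1 h2
    · simp [h1]
    · simp [h1]
    · simp [h1, (Fin.succ_ne_zero _).symm]
  have h1 : (φ (y s) ∩ φ (y t)).card = F (insert k J) := by
    rw [hF (y s) (y t)]
    · congr 1
      ext i
      simp only [Finset.mem_filter, Finset.mem_univ, true_and, y, Finset.mem_insert]
      split_ifs with h1 h2
      · simp [h1]
      · simp [h2]
      · simp [h1, h2, hst]
    · intro i
      simp only [y]
      split_ifs
      · exact le_rfl
      · exact le_rfl
      · exact Fin.succ_le_succ_iff.mpr hlt.le
  rw [← h0, ← h1]
  refine Finset.card_le_card fun a ha => Finset.mem_inter.mpr ⟨(Finset.mem_inter.mp ha).2, ?_⟩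
  have h' : φ 0 ∩ φ (y s) = φ 0 ∩ φ (y t) := h
  rw [h'] at ha
  exact (Finset.mem_inter.mp ha).2

/-- A homogeneous map on a grid which fixes no intersection is constant. -/
theorem grid_constant {p : ℕ} (φ : (Fin p → Fin (2 ^ p + 1 + 1)) → Finset ℕ)
    (hφ : ∀ v, (φ v).card = p) (F : Finset (Fin p) → ℕ)
    (hF : ∀ v w, v ≤ w → (φ v ∩ φ w).card = F {i | v i = w i})
    (hne : ∀ J, J ≠ Finset.univ → F J ≠ J.card) (v : Fin p → Fin (2 ^ p + 1 + 1)) :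
    φ v = φ 0 := by
  classical
  have hlt : ∀ J : Finset (Fin p), J ≠ Finset.univ → J.card < F J := by
    intro J
    induction J using Finset.induction with
    | empty => intro h; exact Nat.pos_of_ne_zero (by simpa using hne ∅ h)
    | insert k J hk ih =>
      intro h
      have h1 := ih (fun h' => hk (h' ▸ Finset.mem_univ k))
      have h2 := grid_inter_card_le_insert φ hφ F hF J k
      have h3 := hne _ h
      rw [Finset.card_insert_of_notMem hk] at h3 ⊢
      omega
  have hstep : ∀ (u : Fin p → Fin (2 ^ p + 1 + 1)) k b, u k ≤ b →
      φ (Function.update u k b) = φ u := by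
    intro u k b hb
    rcases hb.eq_or_lt with rfl | hb'
    · rw [Function.update_eq_self]
    have h1 := hF u (Function.update u k b) (le_update_iff.mpr ⟨hb, fun _ _ => le_rfl⟩)
    have h2 : ({i | u i = Function.update u k b i} : Finset (Fin p)) = Finset.univ.erase k := by
      ext i
      rcases eq_or_ne i k with rfl | hi
      · simp [hb'.ne]
      · simp [hi]
    have h3 := hlt (Finset.univ.erase k) (fun h =>
      Finset.notMem_erase k Finset.univ (by rw [h]; exact Finset.mem_univ k))
    rw [Finset.card_erase_of_mem (Finset.mem_univ k), Finset.card_univ, Fintype.card_fin] at h3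
    rw [h2] at h1
    have h4 : φ u ∩ φ (Function.update u k b) = φ u :=
      Finset.eq_of_subset_of_card_le Finset.inter_subset_left (by rw [hφ]; omega)
    have h5 : φ u ∩ φ (Function.update u k b) = φ (Function.update u k b) :=
      Finset.eq_of_subset_of_card_le Finset.inter_subset_right (by rw [hφ]; omega)
    rw [← h5, h4]
  have hS : ∀ S : Finset (Fin p), φ (S.piecewise v 0) = φ 0 := by
    intro S
    induction S using Finset.induction with
    | empty => simp
    | insert k S hk ih =>
      rw [Finset.piecewise_insert, hstep _ _ _ (by simp [hk]), ih]
  simpa using hS Finset.univ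

/-- If `f` is constant on the transversals of a family of `p` large disjoint sets and fixes no
intersection, then it is constant. -/
theorem constant_of_constant_on_transversals {p K : ℕ} (hK : p < K) (B : Finset ℕ)
    (f : Finset ℕ → Finset ℕ)
    (hf : ∀ x ⊆ B, x.card = p → (f x).card = p)
    (hfix : ∀ x ⊆ B, x.card = p → ∀ y ⊆ B, y.card = p → x ≠ y →
      (f x ∩ f y).card ≠ (x ∩ y).card)
    (G : Fin p → Fin K → ℕ) (hG : ∀ i s j t, G i s = G j t → i = j ∧ s = t)
    (hGB : ∀ i s, G i s ∈ B) (c : Finset ℕ) (hc : c.card = p)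
    (hconst : ∀ v : Fin p → Fin K, f (Finset.univ.image fun i => G i (v i)) = c)
    (u : Finset ℕ) (hu : u ⊆ B) (hup : u.card = p) : f u = c := by
  classical
  have hinj : ∀ v : Fin p → Fin K, Function.Injective fun i => G i (v i) :=
    fun v i j h => (hG _ _ _ _ h).1
  suffices h : ∀ S : Finset (Fin p), ∀ u ⊆ B, u.card = p → ∀ s : Fin p → Fin K,
      (∀ i ∈ Sᶜ, G i (s i) ∈ u) → f u = c from
    h Finset.univ u hu hup (fun _ => ⟨0, by omega⟩) (by simp)
  intro S
  induction S using Finset.induction with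
  | empty =>
    intro u hu hup s hs
    rw [← hconst s]
    congr 1
    refine (Finset.eq_of_subset_of_card_le ?_ ?_).symm
    · intro a ha
      obtain ⟨i, -, rfl⟩ := Finset.mem_image.mp ha
      exact hs i (by simp)
    · rw [Finset.card_image_of_injective _ (hinj s), hup]; simp
  | insert k S' hk ih =>
    intro u hu hup s hs
    by_contra hne
    set S := (insert k S')ᶜ with hSdef
    have hkS : k ∉ S := by simp [hSdef]
    have hS' : S'ᶜ = insert k S := by
      ext i
      rcases eq_or_ne i k with rfl | hi
      · simp [hk]
      · simp [hSdef, hi]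
    have hfresh : ∀ i, ∃ r, G i r ∉ u := by
      intro i
      by_contra! h
      have : (Finset.univ.image (G i)).card ≤ u.card :=
        Finset.card_le_card (by intro a ha; obtain ⟨r, -, rfl⟩ := Finset.mem_image.mp ha; exact h r)
      rw [Finset.card_image_of_injective _ (fun a b h => (hG _ _ _ _ h).2), hup] at this
      simp at this
      omega
    choose r hr using hfresh
    set q := (f u ∩ c).card with hq
    have hqp : q < p := by
      refine lt_of_le_of_ne ((Finset.card_le_card Finset.inter_subset_right).trans hc.le) ?_
      intro h
      have h1 := Finset.eq_of_subset_of_card_le (Finset.inter_subset_left (s₁ := f u) (s₂ := c))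
        (by rw [hf u hu hup]; omega)
      have h2 := Finset.eq_of_subset_of_card_le (Finset.inter_subset_right (s₁ := f u) (s₂ := c))
        (by rw [hc]; omega)
      exact hne (h1.symm.trans h2)
    let t := S.image fun i => G i (s i)
    have htu : t ⊆ u := by
      intro a ha
      obtain ⟨i, hi, rfl⟩ := Finset.mem_image.mp ha
      exact hs i hi
    have htc : t.card = S.card := Finset.card_image_of_injective _ (hinj s)
    have hSp : S.card + 1 ≤ p := by
      rw [← Finset.card_insert_of_notMem hkS]
      simpa using Finset.card_le_univ (insert k S)
    obtain ⟨W, hWu, hWq, hW⟩ : ∃ W ⊆ u, W.card = q ∧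
        (insert k S \ S.filter fun i => G i (s i) ∈ W).card ≤ p - q := by
      have hcard : ∀ W : Finset ℕ, (insert k S \ S.filter fun i => G i (s i) ∈ W).card
          = S.card + 1 - (S.filter fun i => G i (s i) ∈ W).card := by
        intro W
        rw [Finset.card_sdiff_of_subset
          ((Finset.filter_subset _ _).trans (Finset.subset_insert _ _)),
          Finset.card_insert_of_notMem hkS]
      rcases le_total q t.card with h | h
      · obtain ⟨W, hWt, hWq⟩ := Finset.exists_subset_card_eq h
        refine ⟨W, hWt.trans htu, hWq, ?_⟩
        have h1 : W ⊆ (S.filter fun i => G i (s i) ∈ W).image fun i => G i (s i) := by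
          intro a ha
          obtain ⟨i, hi, rfl⟩ := Finset.mem_image.mp (hWt ha)
          exact Finset.mem_image_of_mem _ (Finset.mem_filter.mpr ⟨hi, ha⟩)
        have h2 := (Finset.card_le_card h1).trans Finset.card_image_le
        rw [hcard]
        omega
      · obtain ⟨W, htW, hWu, hWq⟩ := Finset.exists_subsuperset_card_eq htu h (by omega)
        refine ⟨W, hWu, hWq, ?_⟩
        have h1 : (S.filter fun i => G i (s i) ∈ W) = S :=
          Finset.filter_true_of_mem fun i hi => htW (Finset.mem_image_of_mem _ hi)
        rw [hcard, h1]
        omega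
    obtain ⟨Q, hQ, -, hQc⟩ := Finset.exists_subsuperset_card_eq
      (Finset.subset_univ (insert k S \ S.filter fun i => G i (s i) ∈ W)) hW (by simp)
    let R := Q.image fun i => G i (r i)
    have hRu : Disjoint R u := by
      rw [Finset.disjoint_left]
      intro a ha
      obtain ⟨i, -, rfl⟩ := Finset.mem_image.mp ha
      exact hr i
    have hyu : u ∩ (R ∪ W) = W := by
      rw [Finset.inter_union_distrib_left, Finset.inter_comm,
        Finset.disjoint_iff_inter_eq_empty.mp hRu, Finset.empty_union, Finset.inter_eq_right.mpr hWu]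
    have hyB : R ∪ W ⊆ B := by
      refine Finset.union_subset ?_ (hWu.trans hu)
      intro a ha
      obtain ⟨i, -, rfl⟩ := Finset.mem_image.mp ha
      exact hGB _ _
    have hyp : (R ∪ W).card = p := by
      rw [Finset.card_union_of_disjoint (hRu.mono_right hWu),
        Finset.card_image_of_injective _ (hinj r), hQc, hWq]
      omega
    have hfy : f (R ∪ W) = c := by
      refine ih (R ∪ W) hyB hyp (fun i => if i ∈ S ∧ G i (s i) ∈ W then s i else r i) ?_
      intro i hi
      rw [hS'] at hi
      split_ifs with h
      · exact Finset.mem_union_right _ h.2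
      · refine Finset.mem_union_left _ (Finset.mem_image_of_mem _ (hQ ?_))
        rw [Finset.mem_sdiff, Finset.mem_filter]
        exact ⟨hi, h⟩
    refine hfix u hu hup (R ∪ W) hyB hyp ?_ ?_
    · intro h
      rw [← h] at hfy
      exact hne hfy
    · rw [hfy, hyu, hWq]

/-- Every large set contains `p` consecutive blocks of size `2 ^ p + 2` such that, for transversals
`v ≤ w`, the size of `f v ∩ f w` depends only on the places where `v` and `w` agree. -/
theorem exists_homogeneous_grid (p : ℕ) :
    ∃ N : ℕ, ∀ B : Finset ℕ, N ≤ B.card → ∀ f : Finset ℕ → Finset ℕ,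
      (∀ x ⊆ B, x.card = p → (f x).card = p) →
      ∃ G : Fin p → Fin (2 ^ p + 1 + 1) → ℕ, (∀ i s j t, G i s = G j t → i = j ∧ s = t) ∧
        (∀ i s, G i s ∈ B) ∧ ∃ F : Finset (Fin p) → ℕ, ∀ v w : Fin p → Fin (2 ^ p + 1 + 1), v ≤ w →
          (f (Finset.univ.image fun i => G i (v i)) ∩
            f (Finset.univ.image fun i => G i (w i))).card = F {i | v i = w i} := by
  classical
  obtain ⟨N, hN⟩ := exists_homogeneous (C := Finset (Fin p) → Fin (p + 1)) (p * 2)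
    (p * (2 ^ p + 1 + 1 + 1))
  refine ⟨N, fun B hB f hf => ?_⟩
  obtain ⟨H, hHB, hHc, c, hc⟩ := hN B hB fun z J => Fin.ofNat (p + 1)
    (f (Finset.univ.image fun i => z (finProdFinEquiv (i, 0))) ∩
      f (Finset.univ.image fun i => z (finProdFinEquiv (i, if i ∈ J then 0 else 1)))).card
  let D : Fin p → Fin (2 ^ p + 1 + 1 + 1) → ℕ :=
    fun i s => H.orderEmbOfFin hHc (finProdFinEquiv (i, s))
  have hDH : ∀ i s, D i s ∈ H := fun i s => Finset.orderEmbOfFin_mem _ _ _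
  have hDinj : ∀ i s j t, D i s = D j t → i = j ∧ s = t := by
    intro i s j t h
    simpa only [Prod.mk.injEq] using
      finProdFinEquiv.injective ((H.orderEmbOfFin hHc).injective h)
  have hDlt : ∀ i s j t, (i < j ∨ i = j ∧ s < t) → D i s < D j t := by
    intro i s j t h
    refine (H.orderEmbOfFin hHc).strictMono ?_
    rw [Fin.lt_def]
    simp only [finProdFinEquiv_apply_val]
    rcases h with h | ⟨rfl, h⟩
    · have h1 : (i : ℕ) + 1 ≤ j := h
      have h2 := Nat.mul_le_mul_left (2 ^ p + 1 + 1 + 1) h1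
      have h3 := s.isLt
      rw [Nat.mul_add] at h2
      omega
    · have : (s : ℕ) < t := h
      omega
  refine ⟨fun i s => D i s.castSucc, ?_, fun i s => hHB (hDH _ _), fun J => c J, ?_⟩
  · intro i s j t h
    have := hDinj _ _ _ _ h
    exact ⟨this.1, Fin.castSucc_injective _ this.2⟩
  intro v w hvw
  let d : Fin p → Fin 2 → Fin (2 ^ p + 1 + 1 + 1) := fun i b =>
    if b = 0 then (v i).castSucc else if v i = w i then (v i).succ else (w i).castSucc
  have hd : ∀ i, d i 0 < d i 1 := by
    intro i
    simp only [d, if_true, one_ne_zero, if_false]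
    split_ifs with h
    · exact Fin.castSucc_lt_succ
    · exact Fin.castSucc_lt_castSucc_iff.mpr (lt_of_le_of_ne (hvw i) h)
  let z : Fin (p * 2) → ℕ := fun k =>
    D (finProdFinEquiv.symm k).1 (d (finProdFinEquiv.symm k).1 (finProdFinEquiv.symm k).2)
  have hzd : ∀ i b, z (finProdFinEquiv (i, b)) = D i (d i b) := fun i b => by
    simp only [z, Equiv.symm_apply_apply]
  have hz : StrictMono z := by
    intro k l hkl
    obtain ⟨⟨i, a⟩, rfl⟩ := finProdFinEquiv.surjective k
    obtain ⟨⟨j, b⟩, rfl⟩ := finProdFinEquiv.surjective l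
    rw [hzd, hzd]
    rw [Fin.lt_def] at hkl
    simp only [finProdFinEquiv_apply_val] at hkl
    have ha := a.isLt
    have hb := b.isLt
    rcases lt_trichotomy i j with h | rfl | h
    · exact hDlt _ _ _ _ (Or.inl h)
    · have ha0 : a = 0 := Fin.ext (by simp; omega)
      have hb1 : b = 1 := Fin.ext (by simp; omega)
      subst ha0 hb1
      exact hDlt _ _ _ _ (Or.inr ⟨rfl, hd _⟩)
    · have : (j : ℕ) < i := h
      omega
  have key := congrFun (hc z hz fun k => hDH _ _) ({i | v i = w i} : Finset (Fin p))
  have hv : (fun i => z (finProdFinEquiv (i, 0))) = fun i => D i (v i).castSucc := by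
    funext i
    simp only [hzd, d, if_true]
  have hw : (fun i => z (finProdFinEquiv
      (i, if i ∈ ({i | v i = w i} : Finset (Fin p)) then 0 else 1))) =
      fun i => D i (w i).castSucc := by
    funext i
    by_cases h : v i = w i <;> simp only [hzd] <;> simp [d, h]
  simp only [hv, hw] at key
  dsimp only
  rw [← key, Fin.val_ofNat, Nat.mod_eq_of_lt]
  refine Nat.lt_succ_of_le ((Finset.card_le_card Finset.inter_subset_left).trans (hf _ ?_ ?_).le)
  · intro a ha
    obtain ⟨i, -, rfl⟩ := Finset.mem_image.mp ha
    exact hHB (hDH _ _)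
  · rw [Finset.card_image_of_injective _ fun i j h => (hDinj _ _ _ _ h).1]
    simp

theorem stmt_3 (p : ℕ) (hp : 1 ≤ p) :
    ∃ n₀ : ℕ, p + 1 ≤ n₀ ∧ ∀ n : ℕ, n₀ ≤ n →
      ∀ f : Finset ℕ → Finset ℕ,
        (∀ x : Finset ℕ, x ⊆ Finset.Icc 1 n → x.card = p → (f x).card = p) →
        (∃ x y : Finset ℕ, x ⊆ Finset.Icc 1 n ∧ x.card = p ∧
          y ⊆ Finset.Icc 1 n ∧ y.card = p ∧ f x ≠ f y) →
        ∃ x y : Finset ℕ, x ⊆ Finset.Icc 1 n ∧ x.card = p ∧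
          y ⊆ Finset.Icc 1 n ∧ y.card = p ∧ x ≠ y ∧
          (f x ∩ f y).card = (x ∩ y).card := by
  classical
  obtain ⟨N, hN⟩ := exists_homogeneous_grid p
  refine ⟨max N (p + 1), le_max_right _ _, fun n hn f hf hnc => ?_⟩
  by_contra hcon
  have hfix : ∀ x ⊆ Finset.Icc 1 n, x.card = p → ∀ y ⊆ Finset.Icc 1 n, y.card = p → x ≠ y →
      (f x ∩ f y).card ≠ (x ∩ y).card :=
    fun x hx hxp y hy hyp hxy h => hcon ⟨x, y, hx, hxp, hy, hyp, hxy, h⟩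
  obtain ⟨G, hG, hGB, F, hF⟩ := hN (Finset.Icc 1 n) (by
    simpa using (le_max_left _ _).trans hn) f hf
  have hinj : ∀ v : Fin p → Fin (2 ^ p + 1 + 1), Function.Injective fun i => G i (v i) :=
    fun v i j h => (hG _ _ _ _ h).1
  have hXB : ∀ v : Fin p → Fin (2 ^ p + 1 + 1),
      (Finset.univ.image fun i => G i (v i)) ⊆ Finset.Icc 1 n := by
    intro v a ha
    obtain ⟨i, -, rfl⟩ := Finset.mem_image.mp ha
    exact hGB _ _
  have hXp : ∀ v : Fin p → Fin (2 ^ p + 1 + 1),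
      (Finset.univ.image fun i => G i (v i)).card = p := by
    intro v
    rw [Finset.card_image_of_injective _ (hinj v)]
    simp
  have hFne : ∀ J, J ≠ Finset.univ → F J ≠ J.card := by
    intro J hJ hFJ
    let w : Fin p → Fin (2 ^ p + 1 + 1) := fun i => if i ∈ J then 0 else Fin.succ 0
    have hJw : ({i | (0 : Fin p → Fin (2 ^ p + 1 + 1)) i = w i} : Finset (Fin p)) = J := by
      ext i
      by_cases h : i ∈ J <;> simp [w, h]
    have hXX : (Finset.univ.image fun i => G i ((0 : Fin p → Fin (2 ^ p + 1 + 1)) i)) ∩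
        (Finset.univ.image fun i => G i (w i)) = J.image fun i => G i (w i) := by
      ext a
      simp only [Finset.mem_inter, Finset.mem_image, Finset.mem_univ, true_and]
      constructor
      · rintro ⟨⟨i, rfl⟩, j, hj⟩
        obtain ⟨rfl, h⟩ := hG _ _ _ _ hj
        refine ⟨j, ?_, hj⟩
        rw [← hJw]
        simpa using h.symm
      · rintro ⟨i, hi, rfl⟩
        refine ⟨⟨i, ?_⟩, i, rfl⟩
        simp [w, hi]
    have hcard : ((Finset.univ.image fun i => G i ((0 : Fin p → Fin (2 ^ p + 1 + 1)) i)) ∩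
        (Finset.univ.image fun i => G i (w i))).card = J.card := by
      rw [hXX, Finset.card_image_of_injective _ (hinj w)]
    refine hfix _ (hXB 0) (hXp 0) _ (hXB w) (hXp w) ?_ ?_
    · intro h
      rw [← h, Finset.inter_self, hXp] at hcard
      exact hJ ((Finset.card_eq_iff_eq_univ J).mp (by simp [← hcard]))
    · rw [hcard, hF 0 w (fun i => Fin.zero_le _), hJw, hFJ]
  have hconst := grid_constant (fun v => f (Finset.univ.image fun i => G i (v i)))
    (fun v => hf _ (hXB v) (hXp v)) F hF hFne
  have hall := constant_of_constant_on_transversals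
    (by have := Nat.lt_two_pow_self (n := p); omega) (Finset.Icc 1 n) f hf hfix G hG hGB _
    (hf _ (hXB 0) (hXp 0)) hconst
  obtain ⟨x, y, hx, hxp, hy, hyp, hxy⟩ := hnc
  exact hxy ((hall x hx hxp).trans (hall y hy hyp).symm)
end

section
/- There exists a graph G whose edges can be 6-coloured without a monochromatic K₄, yet for every 6-colouring of the edges of G (with the six colours partitioned into three pairs of 'opposite' colours) there is either a monochromatic 4-clique or a 'special' 4-clique: a 4-clique in which two independent edges get some colour c₁ and the remaining four edges get the opposite colour c₂. -/
/-- Six colours partitioned into three pairs of opposite colours: a colour is a pair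
`(i, x) : Fin 3 × Bool`, and `(i, x)` and `(i, !x)` are opposite. -/
abbrev SixColours := Fin 3 × Bool

/-- Finite edge-coloured graphs over a set `X` of parts, with no edge inside a part and no
monochromatic clique on `r` vertices. -/
structure PartiteSystem (X K : Type) (r : ℕ) where
  V : Type
  finite : Finite V
  part : V → X
  Adj : K → V → V → Prop
  symm : ∀ {i u v}, Adj i u v → Adj i v u
  part_ne : ∀ {i u v}, Adj i u v → part u ≠ part v
  disjoint : ∀ {i j u v}, Adj i u v → Adj j u v → i = j
  cliqueFree : ∀ i (w : Fin r → V), ¬ ∀ a b, a ≠ b → Adj i (w a) (w b)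

namespace PartiteSystem

open Combinatorics

variable {X K : Type} {r : ℕ}

/-- Maps preserving parts and coloured adjacency. -/
structure Hom (P Q : PartiteSystem X K r) where
  toFun : P.V → Q.V
  map_part : ∀ v, Q.part (toFun v) = P.part v
  map_adj : ∀ {i u v}, P.Adj i u v → Q.Adj i (toFun u) (toFun v)

/-- The edges of colour `i` from part `x` to part `y`. -/
abbrev EdgeBetween (P : PartiteSystem X K r) (x y : X) (i : K) : Type :=
  {e : P.V × P.V // P.part e.1 = x ∧ P.part e.2 = y ∧ P.Adj i e.1 e.2}

/-- Vertices of the amalgam of copies of `P`, one for each line in a power of the set of edges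
of colour `i` from `x` to `y`. -/
abbrev AmalgamVertex (P : PartiteSystem X K r) (x y : X) (i : K) (ι : Type) : Type :=
  (X × (ι → P.V)) ⊕ (Line (P.EdgeBetween x y i) ι × P.V)

/-- The part of a vertex of the amalgam. -/
def amalgamPart (P : PartiteSystem X K r) (x y : X) (i : K) (ι : Type) :
    P.AmalgamVertex x y i ι → X :=
  Sum.elim Prod.fst (fun p ↦ P.part p.2)

open Classical in
/-- The copy of `P` in the amalgam that belongs to a given line. -/
noncomputable def copy (P : PartiteSystem X K r) {x y : X} {i : K} {ι : Type}
    (l : Line (P.EdgeBetween x y i) ι) (v : P.V) : P.AmalgamVertex x y i ι :=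
  if P.part v = x then .inl (x, fun t ↦ (l.idxFun t).elim v (fun e ↦ e.1.1))
  else if P.part v = y then .inl (y, fun t ↦ (l.idxFun t).elim v (fun e ↦ e.1.2))
  else .inr (l, v)

/-- Adjacency in the amalgam: the union of all copies of `P`. -/
def AmalgamAdj (P : PartiteSystem X K r) {x y : X} {i : K} {ι : Type} (j : K)
    (a b : P.AmalgamVertex x y i ι) : Prop :=
  ∃ l u v, P.Adj j u v ∧ P.copy l u = a ∧ P.copy l v = b

section Amalgam

variable (P : PartiteSystem X K r) {x y : X} {i j : K} {ι : Type}

lemma copy_left (l : Line (P.EdgeBetween x y i) ι) {v : P.V} (h : P.part v = x) :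
    P.copy l v = .inl (x, fun t ↦ (l.idxFun t).elim v (fun e ↦ e.1.1)) := if_pos h

lemma copy_right (hxy : x ≠ y) (l : Line (P.EdgeBetween x y i) ι) {v : P.V}
    (h : P.part v = y) :
    P.copy l v = .inl (y, fun t ↦ (l.idxFun t).elim v (fun e ↦ e.1.2)) := by
  simp [copy, h, hxy.symm]

lemma copy_of_ne (l : Line (P.EdgeBetween x y i) ι) {v : P.V} (hx : P.part v ≠ x)
    (hy : P.part v ≠ y) : P.copy l v = .inr (l, v) := by
  simp [copy, hx, hy]

@[simp]
lemma amalgamPart_copy (l : Line (P.EdgeBetween x y i) ι) (v : P.V) :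
    P.amalgamPart x y i ι (P.copy l v) = P.part v := by
  unfold copy amalgamPart
  split_ifs <;> simp_all

lemma copy_injective (hxy : x ≠ y) (l : Line (P.EdgeBetween x y i) ι) :
    Function.Injective (P.copy l) := by
  intro u v h
  have hp : P.part u = P.part v := by
    rw [← P.amalgamPart_copy l u, h, P.amalgamPart_copy]
  obtain ⟨t, ht⟩ := l.proper
  by_cases hx : P.part u = x
  · rw [P.copy_left l hx, P.copy_left l (hp ▸ hx)] at h
    simpa [ht] using congrFun (congrArg Prod.snd (Sum.inl.inj h)) t
  by_cases hy : P.part u = y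
  · rw [P.copy_right hxy l hy, P.copy_right hxy l (hp ▸ hy)] at h
    simpa [ht] using congrFun (congrArg Prod.snd (Sum.inl.inj h)) t
  rw [P.copy_of_ne l hx hy, P.copy_of_ne l (hp ▸ hx) (hp ▸ hy)] at h
  exact congrArg Prod.snd (Sum.inr.inj h)

lemma eq_of_copy_eq_of_ne {l l' : Line (P.EdgeBetween x y i) ι} {u p : P.V}
    (hx : P.part u ≠ x) (hy : P.part u ≠ y) (h : P.copy l' p = P.copy l u) : l' = l := by
  have hp : P.part p = P.part u := by
    rw [← P.amalgamPart_copy l' p, h, P.amalgamPart_copy]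
  rw [P.copy_of_ne l hx hy, P.copy_of_ne l' (hp ▸ hx) (hp ▸ hy)] at h
  exact congrArg Prod.fst (Sum.inr.inj h)

lemma AmalgamAdj.symm {P : PartiteSystem X K r} {a b : P.AmalgamVertex x y i ι}
    (h : P.AmalgamAdj j a b) : P.AmalgamAdj j b a := by
  obtain ⟨l, u, v, huv, ha, hb⟩ := h
  exact ⟨l, v, u, P.symm huv, hb, ha⟩

lemma adj_of_amalgamAdj_copy_left_right (hxy : x ≠ y) {l : Line (P.EdgeBetween x y i) ι}
    {u v : P.V} (hu : P.part u = x) (hv : P.part v = y)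
    (h : P.AmalgamAdj j (P.copy l u) (P.copy l v)) : P.Adj j u v := by
  obtain ⟨l', p, q, hpq, hp, hq⟩ := h
  have hpu : P.part p = x := by rw [← P.amalgamPart_copy l' p, hp, P.amalgamPart_copy, hu]
  have hqv : P.part q = y := by rw [← P.amalgamPart_copy l' q, hq, P.amalgamPart_copy, hv]
  rw [P.copy_left l hu, P.copy_left l' hpu] at hp
  rw [P.copy_right hxy l hv, P.copy_right hxy l' hqv] at hq
  have hp' := congrFun (congrArg Prod.snd (Sum.inl.inj hp))
  have hq' := congrFun (congrArg Prod.snd (Sum.inl.inj hq))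
  simp only at hp' hq'
  obtain ⟨t, ht⟩ := l.proper
  obtain ⟨s, hs⟩ := l'.proper
  have hpt := hp' t
  have hqt := hq' t
  have hps := hp' s
  have hqs := hq' s
  simp only [ht, hs, Option.elim_none] at hpt hqt hps hqs
  cases ht' : l'.idxFun t with
  | none => simp_all
  | some e =>
    cases hs' : l.idxFun s with
    | none => simp_all
    | some e' =>
      simp only [ht', Option.elim_some] at hpt hqt
      simp only [hs', Option.elim_some] at hps hqs
      have hij : i = j := P.disjoint (hps ▸ hqs ▸ e'.2.2.2) hpq
      subst hij
      exact hpt ▸ hqt ▸ e.2.2.2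

/-- Every copy of `P` is an induced subsystem of the amalgam. -/
lemma adj_of_amalgamAdj_copy (hxy : x ≠ y) {l : Line (P.EdgeBetween x y i) ι} {u v : P.V}
    (h : P.AmalgamAdj j (P.copy l u) (P.copy l v)) : P.Adj j u v := by
  obtain ⟨l', p, q, hpq, hp, hq⟩ := id h
  have hne : P.part u ≠ P.part v := by
    rw [← P.amalgamPart_copy l u, ← P.amalgamPart_copy l v, ← hp, ← hq, P.amalgamPart_copy,
      P.amalgamPart_copy]
    exact P.part_ne hpq
  have hl (hl : l' = l) : P.Adj j u v := by
    subst hl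
    rwa [← P.copy_injective hxy _ hp, ← P.copy_injective hxy _ hq]
  by_cases hu : P.part u ≠ x ∧ P.part u ≠ y
  · exact hl (P.eq_of_copy_eq_of_ne hu.1 hu.2 hp)
  by_cases hv : P.part v ≠ x ∧ P.part v ≠ y
  · exact hl (P.eq_of_copy_eq_of_ne hv.1 hv.2 hq)
  have hcases : (P.part u = x ∧ P.part v = y) ∨ (P.part v = x ∧ P.part u = y) := by grind
  obtain ⟨hu, hv⟩ | ⟨hv, hu⟩ := hcases
  · exact P.adj_of_amalgamAdj_copy_left_right hxy hu hv h
  · exact P.symm (P.adj_of_amalgamAdj_copy_left_right hxy hv hu h.symm)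

end Amalgam

/-- The amalgam of the copies of `P` belonging to the lines in the `ι`-th power of the set of
edges of colour `i` from `x` to `y`. -/
def amalgam (P : PartiteSystem X K r) [Finite X] (hr : 3 ≤ r) {x y : X} (hxy : x ≠ y) (i : K)
    (ι : Type) [Finite ι] : PartiteSystem X K r where
  V := P.AmalgamVertex x y i ι
  finite := by
    have := P.finite
    have : Finite (Line (P.EdgeBetween x y i) ι) :=
      Finite.of_injective Line.idxFun fun l l' h ↦ by cases l; cases l'; simp_all
    infer_instance
  part := P.amalgamPart x y i ι
  Adj j := P.AmalgamAdj j
  symm h := h.symm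
  part_ne := by
    rintro j _ _ ⟨l, u, v, huv, rfl, rfl⟩
    simpa using P.part_ne huv
  disjoint := by
    rintro j k _ _ ⟨l, u, v, huv, rfl, rfl⟩ h
    exact P.disjoint huv (P.adj_of_amalgamAdj_copy hxy h)
  cliqueFree := by
    intro j w hw
    have hinj : Function.Injective fun a ↦ P.amalgamPart x y i ι (w a) := by
      intro a b hab
      by_contra hne
      obtain ⟨l, u, v, huv, ha, hb⟩ := hw a b hne
      simp only [← ha, ← hb, P.amalgamPart_copy] at hab
      exact P.part_ne huv hab
    obtain ⟨a, hax, hay⟩ : ∃ a, P.amalgamPart x y i ι (w a) ≠ x ∧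
        P.amalgamPart x y i ι (w a) ≠ y := by
      classical
      by_contra! hall
      have hsub : Finset.univ.image (fun a ↦ P.amalgamPart x y i ι (w a)) ⊆ {x, y} := by
        intro z hz
        obtain ⟨a, -, rfl⟩ := Finset.mem_image.1 hz
        have := hall a
        simp only [Finset.mem_insert, Finset.mem_singleton]
        tauto
      have hcard := Finset.card_le_card hsub
      rw [Finset.card_image_of_injective _ hinj, Finset.card_fin] at hcard
      have := Finset.card_le_two (a := x) (b := y)
      omega
    have : Nontrivial (Fin r) := Fin.nontrivial_iff_two_le.2 (by omega)
    obtain ⟨b, hb⟩ := exists_ne a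
    obtain ⟨l, u, -, -, hu, -⟩ := hw a b hb.symm
    rw [← hu, P.amalgamPart_copy] at hax hay
    have hcopy (c : Fin r) : ∃ v, P.copy l v = w c := by
      by_cases hc : c = a
      · exact ⟨u, hc ▸ hu⟩
      obtain ⟨l', p, q, -, hp, hq⟩ := hw a c (Ne.symm hc)
      obtain rfl := P.eq_of_copy_eq_of_ne hax hay (hp.trans hu.symm)
      exact ⟨q, hq⟩
    choose v hv using hcopy
    refine P.cliqueFree j v fun c d hcd ↦ P.adj_of_amalgamAdj_copy hxy (l := l) ?_
    rw [hv, hv]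
    exact hw c d hcd

/-- The inclusion of the copy of `P` belonging to a line. -/
noncomputable def copyHom (P : PartiteSystem X K r) [Finite X] (hr : 3 ≤ r) {x y : X}
    (hxy : x ≠ y) {i : K} {ι : Type} [Finite ι] (l : Line (P.EdgeBetween x y i) ι) :
    P.Hom (P.amalgam hr hxy i ι) where
  toFun := P.copy l
  map_part := P.amalgamPart_copy l
  map_adj h := ⟨l, _, _, h, rfl, rfl⟩

variable [Finite X] [Finite K]

lemma exists_forall_hom_between (hr : 3 ≤ r) (P : PartiteSystem X K r) {x y : X} (hxy : x ≠ y)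
    (i : K) : ∃ Q : PartiteSystem X K r, ∀ c : Q.V → Q.V → K, ∃ (f : P.Hom Q) (k : K),
      ∀ u v, P.part u = x → P.part v = y → P.Adj i u v → c (f.toFun u) (f.toFun v) = k := by
  have := P.finite
  obtain ⟨ι, _, hι⟩ := Line.exists_mono_in_high_dimension (P.EdgeBetween x y i) K
  refine ⟨P.amalgam hr hxy i ι, fun c ↦ ?_⟩
  obtain ⟨l, k, hk⟩ := hι fun w ↦
    c (.inl (x, fun t ↦ (w t).1.1)) (.inl (y, fun t ↦ (w t).1.2))
  refine ⟨P.copyHom hr hxy l, k, fun u v hu hv huv ↦ ?_⟩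
  rw [← hk ⟨(u, v), hu, hv, huv⟩]
  change c (P.copy l u) (P.copy l v) = _
  rw [P.copy_left l hu, P.copy_right hxy l hv]
  have h₁ : (fun t ↦ (l.idxFun t).elim u (fun e ↦ e.1.1)) =
      fun t ↦ (l ⟨(u, v), hu, hv, huv⟩ t).1.1 := by
    ext t; cases h : l.idxFun t <;> simp [h]
  have h₂ : (fun t ↦ (l.idxFun t).elim v (fun e ↦ e.1.2)) =
      fun t ↦ (l ⟨(u, v), hu, hv, huv⟩ t).1.2 := by
    ext t; cases h : l.idxFun t <;> simp [h]
  rw [h₁, h₂]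

/-- The edge partition theorem for systems without monochromatic `r`-cliques: in some larger
system, every colouring admits a copy of `P` on which the new colour of an edge depends
only on its ends' parts and its old colour. -/
theorem exists_forall_hom (hr : 3 ≤ r) (P : PartiteSystem X K r) :
    ∃ Q : PartiteSystem X K r, ∀ c : Q.V → Q.V → K, ∃ (f : P.Hom Q) (χ : X → X → K → K),
      ∀ i u v, P.Adj i u v → c (f.toFun u) (f.toFun v) = χ (P.part u) (P.part v) i := by
  classical
  have := Fintype.ofFinite X
  have := Fintype.ofFinite K
  have key (S : Finset (X × X × K)) : ∃ Q : PartiteSystem X K r, ∀ c : Q.V → Q.V → K,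
      ∃ f : P.Hom Q, ∀ s ∈ S, ∃ k, ∀ u v, P.part u = s.1 → P.part v = s.2.1 →
        P.Adj s.2.2 u v → c (f.toFun u) (f.toFun v) = k := by
    induction S using Finset.induction_on with
    | empty => exact ⟨P, fun c ↦ ⟨⟨id, fun _ ↦ rfl, id⟩, by simp⟩⟩
    | insert s S _ ih =>
      obtain ⟨Q, hQ⟩ := ih
      by_cases hs : s.1 = s.2.1
      · refine ⟨Q, fun c ↦ ?_⟩
        obtain ⟨f, hf⟩ := hQ c
        refine ⟨f, fun s' hs' ↦ ?_⟩
        obtain rfl | hs' := Finset.mem_insert.1 hs'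
        · exact ⟨s'.2.2, fun u v hu hv huv ↦
            absurd (hu.trans (hs.trans hv.symm)) (P.part_ne huv)⟩
        · exact hf s' hs'
      · obtain ⟨Q', hQ'⟩ := Q.exists_forall_hom_between hr hs s.2.2
        refine ⟨Q', fun c ↦ ?_⟩
        obtain ⟨g, k, hg⟩ := hQ' c
        obtain ⟨f, hf⟩ := hQ fun u v ↦ c (g.toFun u) (g.toFun v)
        refine ⟨⟨g.toFun ∘ f.toFun, fun v ↦ (g.map_part _).trans (f.map_part v),
          fun h ↦ g.map_adj (f.map_adj h)⟩, fun s' hs' ↦ ?_⟩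
        obtain rfl | hs' := Finset.mem_insert.1 hs'
        · exact ⟨k, fun u v hu hv huv ↦ hg _ _ ((f.map_part u).trans hu)
            ((f.map_part v).trans hv) (f.map_adj huv)⟩
        · exact hf s' hs'
  obtain ⟨Q, hQ⟩ := key Finset.univ
  refine ⟨Q, fun c ↦ ?_⟩
  obtain ⟨f, hf⟩ := hQ c
  choose k hk using fun s ↦ hf s (Finset.mem_univ s)
  exact ⟨f, fun x y i ↦ k (x, y, i), fun i u v h ↦ hk (_, _, i) u v rfl rfl h⟩

end PartiteSystem

/-- A step towards Ramsey's theorem: a large set has a subset of size `m` on which the colour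
of a pair depends only on its smaller element. -/
lemma exists_subset_color_eq_of_lt (κ : Type) [Finite κ] (m : ℕ) :
    ∃ N : ℕ, ∀ {α : Type} [LinearOrder α] (S : Finset α) (χ : α → α → κ), N ≤ S.card →
      ∃ T ⊆ S, T.card = m ∧ ∃ f : α → κ, ∀ a ∈ T, ∀ b ∈ T, a < b → χ a b = f a := by
  classical
  have := Fintype.ofFinite κ
  induction m with
  | zero =>
    refine ⟨1, fun S χ hS ↦ ⟨∅, by simp, rfl, ?_⟩⟩
    obtain ⟨a, -⟩ := Finset.card_pos.1 hS
    exact ⟨χ a, by simp⟩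
  | succ m ih =>
    obtain ⟨N, hN⟩ := ih
    refine ⟨Fintype.card κ * N + 1, fun {α} _ S χ hS ↦ ?_⟩
    have hne : S.Nonempty := Finset.card_pos.1 (by omega)
    set a := S.min' hne with ha
    have : Nonempty κ := ⟨χ a a⟩
    have haS : a ∈ S := S.min'_mem hne
    obtain ⟨k, -, hk⟩ := Finset.exists_le_card_fiber_of_mul_le_card_of_maps_to
      (s := S.erase a) (t := Finset.univ) (f := χ a) (n := N) (fun _ _ ↦ Finset.mem_univ _)
      Finset.univ_nonempty (by rw [Finset.card_erase_of_mem haS, Finset.card_univ]; omega)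
    obtain ⟨T, hTS, hT, f, hf⟩ := hN _ χ hk
    have hT' : ∀ b ∈ T, b ≠ a ∧ b ∈ S ∧ χ a b = k := fun b hb ↦ by
      simpa [and_assoc] using hTS hb
    have haT : a ∉ T := fun h ↦ (hT' a h).1 rfl
    refine ⟨insert a T, Finset.insert_subset haS fun b hb ↦ (hT' b hb).2.1, by
      rw [Finset.card_insert_of_notMem haT, hT], Function.update f a k, ?_⟩
    intro b hb c hc hbc
    have hac : c ≠ a := by
      rintro rfl
      have : b ∈ S := by
        obtain rfl | hb := Finset.mem_insert.1 hb
        exacts [haS, (hT' b hb).2.1]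
      exact absurd (S.min'_le b this) (not_le.2 hbc)
    have hcT := (Finset.mem_insert.1 hc).resolve_left hac
    obtain rfl | hb := Finset.mem_insert.1 hb
    · simpa using (hT' c hcT).2.2
    · rw [Function.update_of_ne (hT' b hb).1]
      exact hf b hb c hcT hbc

/-- **Ramsey's theorem** for pairs. -/
theorem exists_strictMono_color_eq (κ : Type) [Finite κ] (m : ℕ) :
    ∃ N : ℕ, ∀ χ : Fin N → Fin N → κ,
      ∃ (e : Fin m → Fin N) (k : κ), StrictMono e ∧ ∀ a b, a < b → χ (e a) (e b) = k := by
  classical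
  have := Fintype.ofFinite κ
  obtain ⟨N, hN⟩ := exists_subset_color_eq_of_lt κ (Fintype.card κ * m + 1)
  refine ⟨N, fun χ ↦ ?_⟩
  obtain ⟨T, -, hT, f, hf⟩ := hN Finset.univ χ (by simp)
  obtain ⟨a, -⟩ : T.Nonempty := Finset.card_pos.1 (by omega)
  have : Nonempty κ := ⟨f a⟩
  obtain ⟨k, -, hk⟩ := Finset.exists_le_card_fiber_of_mul_le_card_of_maps_to
    (s := T) (t := Finset.univ) (f := f) (n := m) (fun _ _ ↦ Finset.mem_univ _)
    Finset.univ_nonempty (by rw [Finset.card_univ]; omega)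
  obtain ⟨U, hU, hUm⟩ := Finset.exists_subset_card_eq hk
  have hmem (a : Fin m) : U.orderEmbOfFin hUm a ∈ T ∧ f (U.orderEmbOfFin hUm a) = k := by
    simpa using hU (U.orderEmbOfFin_mem hUm a)
  refine ⟨U.orderEmbOfFin hUm, k, (U.orderEmbOfFin hUm).strictMono, fun a b hab ↦ ?_⟩
  rw [hf _ (hmem a).1 _ (hmem b).1 ((U.orderEmbOfFin hUm).strictMono hab), (hmem a).2]

/-- The disjoint union of all copies of `K₄` on four of the parts `Fin N`, in all colourings in
which the edges `01` and `02` differ in colour. -/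
def tetrahedra (K : Type) [Finite K] (N : ℕ) : PartiteSystem (Fin N) K 4 where
  V := ((Fin 4 ↪ Fin N) × {q : Sym2 (Fin 4) → K // q s(0, 1) ≠ q s(0, 2)}) × Fin 4
  finite := inferInstance
  part v := v.1.1 v.2
  Adj i u v := u.1 = v.1 ∧ u.2 ≠ v.2 ∧ u.1.2.1 s(u.2, v.2) = i
  symm := by
    rintro i ⟨p, a⟩ ⟨p', b⟩ ⟨rfl, hab, h⟩
    exact ⟨rfl, hab.symm, (congrArg p.2.1 Sym2.eq_swap).trans h⟩
  part_ne := by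
    rintro i ⟨p, a⟩ ⟨p', b⟩ ⟨rfl, hab, h⟩
    exact fun h ↦ hab (p.1.injective h)
  disjoint h h' := h.2.2.symm.trans h'.2.2
  cliqueFree := by
    intro i w hw
    have hinj : Function.Injective fun a ↦ (w a).2 := fun a b hab ↦ by
      by_contra hne
      exact (hw a b hne).2.1 hab
    have hsurj := Finite.surjective_of_injective hinj
    have hfst (a : Fin 4) : (w a).1 = (w 0).1 := by
      by_cases ha : a = 0
      · rw [ha]
      · exact (hw a 0 ha).1
    have hq (c d : Fin 4) (hcd : c ≠ d) : (w 0).1.2.1 s(c, d) = i := by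
      obtain ⟨a, rfl⟩ := hsurj c
      obtain ⟨b, rfl⟩ := hsurj d
      have h := (hw a b fun h ↦ hcd (congrArg (fun a ↦ (w a).2) h)).2.2
      rwa [hfst a] at h
    exact (w 0).1.2.2 ((hq 0 1 (by decide)).trans (hq 0 2 (by decide)).symm)

/-- The target colouring of `K₄` that has colour `k` on `01` and `23` and colour `k'` on the four
other edges. -/
def matchingColouring {K : Type} (k k' : K) (a b : Fin 4) : K :=
  if (a = 0 ∧ b = 1) ∨ (a = 2 ∧ b = 3) then k else k'

/-- Given recolourings of the six edges of `K₄`, either all injective or all sending two colours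
to one common colour, some colouring with different colours on `01` and `02` becomes
monochromatic or equal to the matching colouring for two given colours. -/
lemma exists_preimage_colouring {K : Type} [Finite K] {k k' : K} (hk : k ≠ k')
    (σ : Fin 4 → Fin 4 → K → K)
    (hσ : (∀ a b, a < b → Function.Injective (σ a b)) ∨
      ∃ j, ∀ a b, a < b → ∃ i₁ i₂, i₁ ≠ i₂ ∧ σ a b i₁ = j ∧ σ a b i₂ = j) :
    ∃ τ : Fin 4 → Fin 4 → K, τ 0 1 ≠ τ 0 2 ∧
      ((∃ j, ∀ a b, a < b → σ a b (τ a b) = j) ∨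
        ∀ a b, a < b → σ a b (τ a b) = matchingColouring k k' a b) := by
  classical
  obtain hσ | ⟨j, hσ⟩ := hσ
  · have hsurj (a b : Fin 4) (j : K) : ∃ i, a < b → σ a b i = j := by
      by_cases hab : a < b
      · obtain ⟨i, hi⟩ := Finite.surjective_of_injective (hσ a b hab) j
        exact ⟨i, fun _ ↦ hi⟩
      · exact ⟨j, fun h ↦ absurd h hab⟩
    choose ρ hρ using hsurj
    by_cases h : ρ 0 1 k = ρ 0 2 k
    · refine ⟨fun a b ↦ ρ a b (matchingColouring k k' a b), fun h' ↦ hk ?_,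
        .inr fun a b ↦ hρ a b _⟩
      have h' : ρ 0 1 k = ρ 0 2 k' := by simpa [matchingColouring] using h'
      rw [← hρ 0 2 k (by decide), ← h, h', hρ 0 2 k' (by decide)]
    · exact ⟨fun a b ↦ ρ a b k, h, .inl ⟨k, fun a b ↦ hρ a b k⟩⟩
  · have hne (i : K) (a b : Fin 4) : ∃ i', a < b → i' ≠ i ∧ σ a b i' = j := by
      by_cases hab : a < b
      · obtain ⟨i₁, i₂, hi, h₁, h₂⟩ := hσ a b hab
        by_cases h : i₁ = i
        · exact ⟨i₂, fun _ ↦ ⟨h ▸ hi.symm, h₂⟩⟩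
        · exact ⟨i₁, fun _ ↦ ⟨h, h₁⟩⟩
      · exact ⟨j, fun h ↦ absurd h hab⟩
    choose ρ hρ using hne
    refine ⟨fun a b ↦ if a = 0 ∧ b = 1 then ρ k 0 1 else ρ (ρ k 0 1) a b, ?_,
      .inl ⟨j, fun a b hab ↦ ?_⟩⟩
    · simpa using (hρ (ρ k 0 1) 0 2 (by decide)).1.symm
    · dsimp only
      split_ifs with h
      · obtain ⟨rfl, rfl⟩ := h
        exact (hρ k 0 1 hab).2
      · exact (hρ _ a b hab).2

/-- There is a system without monochromatic `K₄` such that every recolouring of its edges has a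
`K₄` that is monochromatic or has the matching colouring for two given colours. -/
theorem exists_partiteSystem_forall_colouring {K : Type} [Finite K] {k k' : K} (hk : k ≠ k') :
    ∃ (N : ℕ) (Q : PartiteSystem (Fin N) K 4), ∀ c : Q.V → Q.V → K, ∃ w : Fin 4 → Q.V,
      (∀ a b, a < b → ∃ i, Q.Adj i (w a) (w b)) ∧
      ((∃ j, ∀ a b, a < b → c (w a) (w b) = j) ∨
        ∀ a b, a < b → c (w a) (w b) = matchingColouring k k' a b) := by
  classical
  obtain ⟨N, hN⟩ := exists_strictMono_color_eq (Option K) 4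
  obtain ⟨Q, hQ⟩ := (tetrahedra K N).exists_forall_hom (by norm_num)
  refine ⟨N, Q, fun c ↦ ?_⟩
  obtain ⟨f, χ, hχ⟩ := hQ c
  have htype (x y : Fin N) : ∃ o : Option K, (o = none → Function.Injective (χ x y)) ∧
      ∀ j, o = some j → ∃ i₁ i₂, i₁ ≠ i₂ ∧ χ x y i₁ = j ∧ χ x y i₂ = j := by
    by_cases h : Function.Injective (χ x y)
    · exact ⟨none, by simp [h]⟩
    · obtain ⟨i₁, i₂, he, hi⟩ := Function.not_injective_iff.1 h
      exact ⟨some (χ x y i₁), by simp, fun j hj ↦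
        ⟨i₁, i₂, hi, Option.some.inj hj, he ▸ Option.some.inj hj⟩⟩
  choose o ho ho' using htype
  obtain ⟨e, t, he, ht⟩ := hN o
  obtain ⟨τ, hτ, hτ'⟩ := exists_preimage_colouring hk (fun a b ↦ χ (e a) (e b)) <| by
    cases t with
    | none => exact .inl fun a b hab ↦ ho _ _ (ht a b hab)
    | some j => exact .inr ⟨j, fun a b hab ↦ ho' _ _ j (ht a b hab)⟩
  let q : Sym2 (Fin 4) → K :=
    Sym2.lift ⟨fun a b ↦ τ (min a b) (max a b), fun a b ↦ by simp only [min_comm, max_comm]⟩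
  have hq (a b : Fin 4) (hab : a < b) : q s(a, b) = τ a b := by
    simp [q, min_eq_left hab.le, max_eq_right hab.le]
  let w (a : Fin 4) : (tetrahedra K N).V :=
    ((⟨e, he.injective⟩, ⟨q, by rwa [hq 0 1 (by decide), hq 0 2 (by decide)]⟩), a)
  have hw (a b : Fin 4) (hab : a < b) : (tetrahedra K N).Adj (τ a b) (w a) (w b) :=
    ⟨rfl, hab.ne, hq a b hab⟩
  have hc (a b : Fin 4) (hab : a < b) :
      c (f.toFun (w a)) (f.toFun (w b)) = χ (e a) (e b) (τ a b) := hχ _ _ _ (hw a b hab)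
  refine ⟨fun a ↦ f.toFun (w a), fun a b hab ↦ ⟨_, f.map_adj (hw a b hab)⟩, ?_⟩
  obtain ⟨j, hj⟩ | h := hτ'
  · exact .inl ⟨j, fun a b hab ↦ (hc a b hab).trans (hj a b hab)⟩
  · exact .inr fun a b hab ↦ (hc a b hab).trans (h a b hab)

theorem stmt_15 :
    ∃ (n : ℕ) (G : SimpleGraph (Fin n)),
      -- (a) the edges of G can be 6-coloured without a monochromatic K₄
      (∃ c : Sym2 (Fin n) → SixColours,
        ∀ v₁ v₂ v₃ v₄ : Fin n,
          G.Adj v₁ v₂ → G.Adj v₁ v₃ → G.Adj v₁ v₄ → G.Adj v₂ v₃ → G.Adj v₂ v₄ → G.Adj v₃ v₄ →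
          ¬ ∃ col : SixColours,
            c s(v₁, v₂) = col ∧ c s(v₁, v₃) = col ∧ c s(v₁, v₄) = col ∧
            c s(v₂, v₃) = col ∧ c s(v₂, v₄) = col ∧ c s(v₃, v₄) = col) ∧
      -- (b) every 6-colouring of the edges of G contains a monochromatic or a special 4-clique
      (∀ c : Sym2 (Fin n) → SixColours,
        -- a monochromatic 4-clique
        (∃ v₁ v₂ v₃ v₄ : Fin n,
          G.Adj v₁ v₂ ∧ G.Adj v₁ v₃ ∧ G.Adj v₁ v₄ ∧ G.Adj v₂ v₃ ∧ G.Adj v₂ v₄ ∧ G.Adj v₃ v₄ ∧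
          ∃ col : SixColours,
            c s(v₁, v₂) = col ∧ c s(v₁, v₃) = col ∧ c s(v₁, v₄) = col ∧
            c s(v₂, v₃) = col ∧ c s(v₂, v₄) = col ∧ c s(v₃, v₄) = col) ∨
        -- or a special 4-clique: two independent edges of colour (i, x) and the remaining
        -- four edges of the opposite colour (i, !x)
        (∃ v₁ v₂ v₃ v₄ : Fin n,
          G.Adj v₁ v₂ ∧ G.Adj v₁ v₃ ∧ G.Adj v₁ v₄ ∧ G.Adj v₂ v₃ ∧ G.Adj v₂ v₄ ∧ G.Adj v₃ v₄ ∧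
          ∃ (i : Fin 3) (x : Bool),
            c s(v₁, v₂) = (i, x) ∧ c s(v₃, v₄) = (i, x) ∧
            c s(v₁, v₃) = (i, !x) ∧ c s(v₁, v₄) = (i, !x) ∧
            c s(v₂, v₃) = (i, !x) ∧ c s(v₂, v₄) = (i, !x))) := by
  classical
  obtain ⟨N, Q, hQ⟩ :=
    exists_partiteSystem_forall_colouring (K := SixColours) (k := (0, true)) (k' := (0, false))
      (by decide)
  have := Q.finite
  obtain ⟨n, ⟨e⟩⟩ := Finite.exists_equiv_fin Q.V
  let G : SimpleGraph (Fin n) :=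
    { Adj := fun a b ↦ ∃ i, Q.Adj i (e.symm a) (e.symm b)
      symm := ⟨fun a b ⟨i, h⟩ ↦ ⟨i, Q.symm h⟩⟩
      loopless := ⟨fun a ⟨i, h⟩ ↦ Q.part_ne h rfl⟩ }
  refine ⟨n, G, ?_, fun c ↦ ?_⟩
  · have hex (s : Sym2 (Fin n)) : ∃ k : SixColours, ∀ a b i, s = s(a, b) →
        Q.Adj i (e.symm a) (e.symm b) → i = k := by
      by_cases h : ∃ a b i, s = s(a, b) ∧ Q.Adj i (e.symm a) (e.symm b)
      · obtain ⟨a, b, i, rfl, hi⟩ := h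
        refine ⟨i, fun a' b' j hs hj ↦ ?_⟩
        obtain ⟨rfl, rfl⟩ | ⟨rfl, rfl⟩ := Sym2.eq_iff.1 hs
        exacts [Q.disjoint hj hi, Q.disjoint hj (Q.symm hi)]
      · exact ⟨(0, true), fun a b i hs hi ↦ absurd ⟨a, b, i, hs, hi⟩ h⟩
    choose c hc using hex
    have hadj {a b : Fin n} {k : SixColours} (hab : G.Adj a b) (h : c s(a, b) = k) :
        Q.Adj k (e.symm a) (e.symm b) := by
      obtain ⟨i, hi⟩ := hab
      rwa [← h, ← hc _ a b i rfl hi]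
    refine ⟨c, ?_⟩
    rintro v₁ v₂ v₃ v₄ h₁₂ h₁₃ h₁₄ h₂₃ h₂₄ h₃₄ ⟨k, c₁₂, c₁₃, c₁₄, c₂₃, c₂₄, c₃₄⟩
    have a₁₂ := hadj h₁₂ c₁₂
    have a₁₃ := hadj h₁₃ c₁₃
    have a₁₄ := hadj h₁₄ c₁₄
    have a₂₃ := hadj h₂₃ c₂₃
    have a₂₄ := hadj h₂₄ c₂₄
    have a₃₄ := hadj h₃₄ c₃₄
    refine Q.cliqueFree k ![e.symm v₁, e.symm v₂, e.symm v₃, e.symm v₄] fun a b hab ↦ ?_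
    fin_cases a <;> fin_cases b <;>
      first | exact absurd rfl hab | assumption | exact Q.symm (by assumption)
  · obtain ⟨w, hw, hcol⟩ := hQ fun u v ↦ c s(e u, e v)
    have hG (a b : Fin 4) (hab : a < b) : G.Adj (e (w a)) (e (w b)) := by
      simpa [G] using hw a b hab
    obtain ⟨j, hj⟩ | h := hcol
    · exact .inl ⟨e (w 0), e (w 1), e (w 2), e (w 3), hG _ _ (by decide), hG _ _ (by decide),
        hG _ _ (by decide), hG _ _ (by decide), hG _ _ (by decide), hG _ _ (by decide), j,
        hj _ _ (by decide), hj _ _ (by decide), hj _ _ (by decide), hj _ _ (by decide),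
        hj _ _ (by decide), hj _ _ (by decide)⟩
    · exact .inr ⟨e (w 0), e (w 1), e (w 2), e (w 3), hG _ _ (by decide), hG _ _ (by decide),
        hG _ _ (by decide), hG _ _ (by decide), hG _ _ (by decide), hG _ _ (by decide), 0, true,
        h 0 1 (by decide), h 2 3 (by decide), h 0 2 (by decide), h 0 3 (by decide),
        h 1 2 (by decide), h 1 3 (by decide)⟩
end
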